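/- Let m ≤ n and let C be a unitary 2^n × 2^n complex matrix. Suppose there are functions ε : (ZMod 2)^m → {1, -1, i, -i} and a, b : (ZMod 2)^m → (ZMod 2)^n such that C† Z̃(t) C = ε(t) · X(a(t)) Z(b(t)) for every t ∈ (ZMod 2)^m (C† is the conjugate transpose of C). Let p = Σ_{x : x_i = 0 for all i < m} |(C e_0)_x|² be the probability of obtaining the all-zero outcome when the first m qubits of the state C e_0 are measured in the computational basis (e_0 being the basis vector indexed by the all-zeros string). Then T₀ = {t ∈ (ZMod 2)^m : a(t) = 0} is a ZMod 2-linear subspace of (ZMod 2)^m, and either p = 0 or p = 2^{ℓ - m} where ℓ is the dimension of T₀ over ZMod 2. -/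

import Mathlib

open Matrix BigOperators Complex

noncomputable section

/-- The 2×2 Pauli X matrix, indexed by `ZMod 2`. -/
def pX : Matrix (ZMod 2) (ZMod 2) ℂ := !![0, 1; 1, 0]

/-- The 2×2 Pauli Z matrix, indexed by `ZMod 2`. -/
def pZ : Matrix (ZMod 2) (ZMod 2) ℂ := !![1, 0; 0, -1]

/-- `X(a) = X^{a_1} ⊗ ⋯ ⊗ X^{a_n}` as a `2^n × 2^n` matrix indexed by bit strings. -/
def XK {n : ℕ} (a : Fin n → ZMod 2) :
    Matrix (Fin n → ZMod 2) (Fin n → ZMod 2) ℂ :=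
  Matrix.of fun y x => ∏ i, (pX ^ (a i).val) (y i) (x i)

/-- `Z(a) = Z^{a_1} ⊗ ⋯ ⊗ Z^{a_n}` as a `2^n × 2^n` matrix indexed by bit strings. -/
def ZK {n : ℕ} (a : Fin n → ZMod 2) :
    Matrix (Fin n → ZMod 2) (Fin n → ZMod 2) ℂ :=
  Matrix.of fun y x => ∏ i, (pZ ^ (a i).val) (y i) (x i)

/-- Standard (computational) basis vector `e_x`. -/
def basisVec {ι : Type*} [DecidableEq ι] (x : ι) : ι → ℂ :=
  fun y => if y = x then 1 else 0

/-- Standard Hermitian inner product, conjugate-linear in the first argument. -/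
def innerC {ι : Type*} [Fintype ι] (v w : ι → ℂ) : ℂ :=
  ∑ x, (starRingEnd ℂ) (v x) * w x

/-- Extension of a bit string in `(ZMod 2)^m` to `(ZMod 2)^n` by zeros (for `m ≤ n`). -/
def extZ {n m : ℕ} (hm : m ≤ n) (t : Fin m → ZMod 2) : Fin n → ZMod 2 :=
  fun i => if h : (i : ℕ) < m then t ⟨i, h⟩ else 0

/-- The character `x ↦ (-1)^{a · x}`, giving the diagonal of `ZK a`. -/
def zSign {n : ℕ} (a x : Fin n → ZMod 2) : ℂ := ∏ i, (-1 : ℂ) ^ ((a i).val * (x i).val)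

theorem zmod_two_eq_zero_or_one : ∀ c : ZMod 2, c = 0 ∨ c = 1 := by decide

theorem pZ_pow_apply (c x y : ZMod 2) :
    (pZ ^ c.val) y x = if y = x then (-1 : ℂ) ^ (c.val * x.val) else 0 := by
  obtain rfl | rfl := zmod_two_eq_zero_or_one c <;>
  obtain rfl | rfl := zmod_two_eq_zero_or_one x <;>
  obtain rfl | rfl := zmod_two_eq_zero_or_one y <;>
  simp only [ZMod.val_zero, ZMod.val_one, pow_zero, pow_one] <;>
    simp [show pZ 0 0 = 1 from rfl, show pZ 0 1 = 0 from rfl, show pZ 1 0 = 0 from rfl,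
      show pZ 1 1 = -1 from rfl]

theorem pX_pow_apply_zero (c y : ZMod 2) :
    (pX ^ c.val) y 0 = if y = c then 1 else 0 := by
  obtain rfl | rfl := zmod_two_eq_zero_or_one c <;>
  obtain rfl | rfl := zmod_two_eq_zero_or_one y <;>
  simp only [ZMod.val_zero, ZMod.val_one, pow_zero, pow_one] <;>
    simp [show pX 0 0 = 0 from rfl, show pX 1 0 = 1 from rfl]

theorem ZK_eq_diagonal {n : ℕ} (a : Fin n → ZMod 2) : ZK a = diagonal (zSign a) := by
  ext y x
  simp only [ZK, of_apply, pZ_pow_apply, diagonal_apply]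
  split_ifs with h
  · subst h
    simp [zSign]
  · obtain ⟨i, hi⟩ := Function.ne_iff.mp h
    exact Finset.prod_eq_zero (Finset.mem_univ i) (if_neg hi)

theorem XK_apply_zero {n : ℕ} (a y : Fin n → ZMod 2) :
    XK a y 0 = if y = a then 1 else 0 := by
  simp only [XK, of_apply, Pi.zero_apply, pX_pow_apply_zero]
  split_ifs with h
  · simp [h]
  · obtain ⟨i, hi⟩ := Function.ne_iff.mp h
    exact Finset.prod_eq_zero (Finset.mem_univ i) (if_neg hi)

theorem zSign_zero_left {n : ℕ} (x : Fin n → ZMod 2) : zSign 0 x = 1 := by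
  simp [zSign]

theorem zSign_zero_right {n : ℕ} (a : Fin n → ZMod 2) : zSign a 0 = 1 := by
  simp [zSign]

theorem zSign_add {n : ℕ} (a b x : Fin n → ZMod 2) :
    zSign (a + b) x = zSign a x * zSign b x := by
  have key : ∀ c d y : ZMod 2, (-1 : ℂ) ^ ((c + d).val * y.val) =
      (-1) ^ (c.val * y.val) * (-1) ^ (d.val * y.val) := by
    intro c d y
    obtain rfl | rfl := zmod_two_eq_zero_or_one c <;>
    obtain rfl | rfl := zmod_two_eq_zero_or_one d <;>
    obtain rfl | rfl := zmod_two_eq_zero_or_one y <;>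
    simp [ZMod.val_one, show (1 + 1 : ZMod 2) = 0 from rfl]
  simp [zSign, key, Finset.prod_mul_distrib]

theorem zSign_single {n : ℕ} (i : Fin n) (x : Fin n → ZMod 2) (hx : x i ≠ 0) :
    zSign (Pi.single i 1) x = -1 := by
  rw [zSign, Finset.prod_eq_single i]
  · simp [(zmod_two_eq_zero_or_one (x i)).resolve_left hx, ZMod.val_one]
  · intro j _ hj
    simp [hj]
  · simp

theorem extZ_zero {n m : ℕ} (hm : m ≤ n) : extZ hm 0 = 0 := by
  ext i
  simp [extZ]

theorem extZ_add {n m : ℕ} (hm : m ≤ n) (s t : Fin m → ZMod 2) :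
    extZ hm (s + t) = extZ hm s + extZ hm t := by
  ext i
  by_cases h : (i : ℕ) < m <;> simp [extZ, h]

theorem extZ_single {n m : ℕ} (hm : m ≤ n) (i : Fin n) (h : (i : ℕ) < m) :
    extZ hm (Pi.single ⟨i, h⟩ 1) = Pi.single i 1 := by
  ext j
  by_cases hj : (j : ℕ) < m
  · simp [extZ, hj, Pi.single_apply, Fin.ext_iff]
  · have : j ≠ i := by rintro rfl; exact hj h
    simp [extZ, hj, this]

/-- A function on a finite additive group that is multiplied by a constant other than `1` under
some translation sums to zero. -/
theorem sum_eq_zero_of_translate {G : Type*} [AddGroup G] [Fintype G] (f : G → ℂ) (g : G) (c : ℂ)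
    (hc : c ≠ 1) (hf : ∀ t, f (t + g) = f t * c) : ∑ t, f t = 0 := by
  have h : ∑ t, f t = (∑ t, f t) * c := by
    rw [Finset.sum_mul, ← Equiv.sum_comp (Equiv.addRight g) f]
    exact Finset.sum_congr rfl fun t _ => hf t
  have h' : (∑ t, f t) * (c - 1) = 0 := by linear_combination -h
  exact (mul_eq_zero.mp h').resolve_right (sub_ne_zero.mpr hc)

theorem sum_zSign_extZ {n m : ℕ} (hm : m ≤ n) (x : Fin n → ZMod 2) :
    ∑ t, zSign (extZ hm t) x = if ∀ i : Fin n, (i : ℕ) < m → x i = 0 then (2 : ℂ) ^ m else 0 := by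
  split_ifs with h
  · have hone : ∀ t, zSign (extZ hm t) x = 1 := by
      intro t
      refine Finset.prod_eq_one fun i _ => ?_
      by_cases hi : (i : ℕ) < m
      · simp [h i hi]
      · simp [extZ, hi]
    simp [hone]
  · push Not at h
    obtain ⟨i, hi, hx⟩ := h
    refine sum_eq_zero_of_translate _ (Pi.single ⟨i, hi⟩ 1) (-1) (by norm_num) fun t => ?_
    rw [extZ_add, zSign_add, extZ_single, zSign_single i x hx]

theorem conj_ZK_apply_zero_zero {n : ℕ} (C : Matrix (Fin n → ZMod 2) (Fin n → ZMod 2) ℂ)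
    (a : Fin n → ZMod 2) :
    (Cᴴ * ZK a * C) 0 0 = ∑ x, (‖C x 0‖ ^ 2 : ℂ) * zSign a x := by
  rw [ZK_eq_diagonal, mul_apply]
  refine Finset.sum_congr rfl fun x _ => ?_
  rw [mul_diagonal, conjTranspose_apply, ← Complex.conj_mul']
  simp only [Complex.star_def]
  ring

theorem sum_conj_ZK_apply_zero_zero {n m : ℕ} (hm : m ≤ n)
    (C : Matrix (Fin n → ZMod 2) (Fin n → ZMod 2) ℂ) :
    ∑ t, (Cᴴ * ZK (extZ hm t) * C) 0 0 =
      2 ^ m * ((∑ x ∈ Finset.univ.filter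
        (fun x : Fin n → ZMod 2 => ∀ i : Fin n, (i : ℕ) < m → x i = 0),
          ‖C x 0‖ ^ 2 : ℝ) : ℂ) := by
  simp_rw [conj_ZK_apply_zero_zero]
  rw [Finset.sum_comm]
  simp_rw [← Finset.mul_sum, sum_zSign_extZ]
  push_cast
  rw [Finset.sum_filter, Finset.mul_sum]
  refine Finset.sum_congr rfl fun x _ => ?_
  split_ifs <;> ring

theorem conj_ZK_add {n : ℕ} {C : Matrix (Fin n → ZMod 2) (Fin n → ZMod 2) ℂ}
    (hC : C ∈ unitaryGroup (Fin n → ZMod 2) ℂ) (a b : Fin n → ZMod 2) :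
    Cᴴ * ZK (a + b) * C = (Cᴴ * ZK a * C) * (Cᴴ * ZK b * C) := by
  have hCC : C * Cᴴ = 1 := mem_unitaryGroup_iff.mp hC
  have hZ : ZK (a + b) = ZK a * ZK b := by
    simp only [ZK_eq_diagonal, diagonal_mul_diagonal, ← zSign_add]
  calc Cᴴ * ZK (a + b) * C = Cᴴ * ZK a * 1 * ZK b * C := by
        rw [hZ]
        simp only [Matrix.mul_assoc, Matrix.one_mul]
    _ = _ := by
        rw [← hCC]
        simp only [Matrix.mul_assoc]

theorem conj_ZK_zero {n : ℕ} {C : Matrix (Fin n → ZMod 2) (Fin n → ZMod 2) ℂ}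
    (hC : C ∈ unitaryGroup (Fin n → ZMod 2) ℂ) : Cᴴ * ZK 0 * C = 1 := by
  have hZ : (ZK 0 : Matrix (Fin n → ZMod 2) (Fin n → ZMod 2) ℂ) = 1 := by
    rw [ZK_eq_diagonal, ← diagonal_one]
    exact congrArg diagonal (funext zSign_zero_left)
  rw [hZ, Matrix.mul_one]
  exact mem_unitaryGroup_iff'.mp hC

theorem smul_XK_mul_ZK_apply_zero {n : ℕ} (c : ℂ) (a b x : Fin n → ZMod 2) :
    (c • (XK a * ZK b)) x 0 = if x = a then c else 0 := by
  rw [Matrix.smul_apply, ZK_eq_diagonal, mul_diagonal, XK_apply_zero, zSign_zero_right]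
  simp

theorem stmt12 (n m : ℕ) (hm : m ≤ n)
    (C : Matrix (Fin n → ZMod 2) (Fin n → ZMod 2) ℂ)
    (hC : C ∈ Matrix.unitaryGroup (Fin n → ZMod 2) ℂ)
    (ε : (Fin m → ZMod 2) → ℂ)
    (hε : ∀ t, ε t ∈ ({1, -1, Complex.I, -Complex.I} : Set ℂ))
    (a b : (Fin m → ZMod 2) → (Fin n → ZMod 2))
    (hconj : ∀ t, Cᴴ * ZK (extZ hm t) * C = ε t • (XK (a t) * ZK (b t))) :
    ∃ T₀ : Submodule (ZMod 2) (Fin m → ZMod 2),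
      (∀ t, t ∈ T₀ ↔ a t = 0) ∧
      ((∑ x ∈ Finset.univ.filter
            (fun x : Fin n → ZMod 2 => ∀ i : Fin n, (i : ℕ) < m → x i = 0),
          ‖C.mulVec (basisVec (0 : Fin n → ZMod 2)) x‖ ^ 2) = 0 ∨
       (∑ x ∈ Finset.univ.filter
            (fun x : Fin n → ZMod 2 => ∀ i : Fin n, (i : ℕ) < m → x i = 0),
          ‖C.mulVec (basisVec (0 : Fin n → ZMod 2)) x‖ ^ 2) =
        (2 : ℝ) ^ (Module.finrank (ZMod 2) T₀) / 2 ^ m) := by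
  set U := fun t => Cᴴ * ZK (extZ hm t) * C with hU
  have hcol : ∀ t x, U t x 0 = if x = a t then ε t else 0 := fun t x => by
    rw [hU]
    dsimp only
    rw [hconj, smul_XK_mul_ZK_apply_zero]
  have hε0 : ∀ t, ε t ≠ 0 := by
    intro t h
    simpa [h, eq_comm] using hε t
  have ha : ∀ t, a t = 0 ↔ U t 0 0 ≠ 0 := by
    intro t
    rw [hcol]
    split_ifs with h
    · simp [h.symm, hε0]
    · simpa using fun h' => h h'.symm
  have hadd : ∀ s t, a t = 0 → U (s + t) 0 0 = U s 0 0 * U t 0 0 := by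
    intro s t ht
    have h : U (s + t) = U s * U t := by
      simp only [hU, extZ_add]
      exact conj_ZK_add hC _ _
    rw [h, mul_apply, Finset.sum_eq_single 0]
    · intro y _ hy
      rw [hcol t, ht, if_neg hy, mul_zero]
    · simp
  have hzero : a 0 = 0 := by
    rw [ha]
    simp [hU, extZ_zero, conj_ZK_zero hC]
  let T₀ : Submodule (ZMod 2) (Fin m → ZMod 2) := AddSubgroup.toZModSubmodule 2
    { carrier := {t | a t = 0}
      zero_mem' := hzero
      add_mem' := fun {s t} hs ht => (ha _).mpr <| by
        rw [hadd s t ht]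
        exact mul_ne_zero ((ha s).mp hs) ((ha t).mp ht)
      neg_mem' := fun {t} ht => by
        rwa [show -t = t from funext fun i => ZMod.neg_eq_self_mod_two (t i)] }
  have hT : ∀ t, t ∈ T₀ ↔ a t = 0 := fun t => Iff.rfl
  refine ⟨T₀, hT, ?_⟩
  have hvec : ∀ x, C.mulVec (basisVec 0) x = C x 0 := by
    intro x
    simp [mulVec, dotProduct, basisVec]
  simp only [hvec]
  have hsum := sum_conj_ZK_apply_zero_zero hm C
  change ∑ t, U t 0 0 = _ at hsum
  set p : ℝ := ∑ x ∈ Finset.univ.filter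
    (fun x : Fin n → ZMod 2 => ∀ i : Fin n, (i : ℕ) < m → x i = 0), ‖C x 0‖ ^ 2
  by_cases h1 : ∀ t, a t = 0 → U t 0 0 = 1
  · right
    have hcard : ∑ t, U t 0 0 = (2 : ℂ) ^ Module.finrank (ZMod 2) T₀ := by
      classical
      have hind : ∀ t, U t 0 0 = if t ∈ T₀ then 1 else 0 := by
        intro t
        split_ifs with h
        · exact h1 t h
        · exact not_not.mp fun h' => h ((ha t).mpr h')
      have hpow := Module.card_eq_pow_finrank (K := ZMod 2) (V := T₀)
      rw [ZMod.card, Fintype.card_subtype] at hpow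
      simp only [hind, Finset.sum_boole]
      exact_mod_cast hpow
    rw [hcard] at hsum
    rw [eq_div_iff (by positivity), mul_comm]
    exact_mod_cast hsum.symm
  · left
    push Not at h1
    obtain ⟨t, ht, hne⟩ := h1
    rw [sum_eq_zero_of_translate _ t _ hne fun s => hadd s t ht] at hsum
    simpa using hsum.symm
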